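/- Let ϱ be a Hermitian d×d complex matrix and let G^{(0)}, …, G^{(k)} : ι×ι → ℂ be coefficient families with G^{(j)}_{nn} = 1 for all n and j. Then the composed partial dephasings satisfy the multi-step equilibration bound ‖(𝒢_{G^{(k)}} ∘ ⋯ ∘ 𝒢_{G^{(0)}})(ϱ) − 𝒟(ϱ)‖₂ ≤ (∏_{j=0}^{k} max_{n≠m} |G^{(j)}_{nm}|) · ‖ϱ − 𝒟(ϱ)‖₂. -/

import Mathlib

open Matrix BigOperators

/-- The Frobenius (Hilbert–Schmidt) norm `‖X‖₂ = √(tr(XᴴX))`. -/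
noncomputable def frob {d : ℕ} (X : Matrix (Fin d) (Fin d) ℂ) : ℝ :=
  Real.sqrt ((Xᴴ * X).trace.re)

/-- The dephasing map `𝒟(X) = Σ_n P_n X P_n`. -/
noncomputable def deph {d : ℕ} {ι : Type*} [Fintype ι]
    (P : ι → Matrix (Fin d) (Fin d) ℂ) (X : Matrix (Fin d) (Fin d) ℂ) :
    Matrix (Fin d) (Fin d) ℂ :=
  ∑ n, P n * X * P n

/-- The partial dephasing map `𝒢_G(X) = Σ_{n,m} G_{nm} P_n X P_m`. -/
noncomputable def pdeph {d : ℕ} {ι : Type*} [Fintype ι]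
    (P : ι → Matrix (Fin d) (Fin d) ℂ) (G : ι → ι → ℂ)
    (X : Matrix (Fin d) (Fin d) ℂ) : Matrix (Fin d) (Fin d) ℂ :=
  ∑ n, ∑ m, G n m • (P n * X * P m)

/-- `max_{n≠m} |G_{nm}|`, the maximum modulus of the off-diagonal coefficients. -/
noncomputable def maxOffDiag {ι : Type*} [Fintype ι] [DecidableEq ι] [Nontrivial ι]
    (G : ι → ι → ℂ) : ℝ :=
  Finset.univ.offDiag.sup'
    (by
      obtain ⟨a, b, hab⟩ := exists_pair_ne ι
      exact ⟨(a, b), Finset.mem_offDiag.mpr ⟨Finset.mem_univ _, Finset.mem_univ _, hab⟩⟩)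
    (fun p => ‖G p.1 p.2‖)

/-- `chainFun f a n = f (a+n−1) ∘ ⋯ ∘ f (a+1) ∘ f a` (the identity when `n = 0`). -/
def chainFun {M : Type*} (f : ℕ → M → M) (a : ℕ) : ℕ → M → M
  | 0, x => x
  | n + 1, x => f (a + n) (chainFun f a n x)

section Blocks

variable {d : ℕ} {ι : Type*} [Fintype ι] {P : ι → Matrix (Fin d) (Fin d) ℂ}

theorem mul_pdeph_mul (hOrth : ∀ n m, n ≠ m → P n * P m = 0) (hIdem : ∀ n, P n * P n = P n)
    (G : ι → ι → ℂ) (X : Matrix (Fin d) (Fin d) ℂ) (a b : ι) :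
    P a * pdeph P G X * P b = G a b • (P a * X * P b) := by
  have key : ∀ n m, P a * (P n * X * P m) * P b = (P a * P n) * X * (P m * P b) := by
    intro n m
    simp only [Matrix.mul_assoc]
  simp only [pdeph, Finset.mul_sum, Finset.sum_mul, Matrix.mul_smul, Matrix.smul_mul, key]
  rw [Finset.sum_eq_single a, Finset.sum_eq_single b]
  · rw [hIdem, hIdem]
  · intro m _ hm
    simp [hOrth m b hm]
  · simp
  · intro n _ hn
    simp [hOrth a n hn.symm]
  · simp

theorem deph_eq_pdeph [DecidableEq ι] (X : Matrix (Fin d) (Fin d) ℂ) :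
    deph P X = pdeph P (fun n m => if n = m then 1 else 0) X := by
  simp [deph, pdeph, ite_smul]

theorem deph_pdeph (hOrth : ∀ n m, n ≠ m → P n * P m = 0) (hIdem : ∀ n, P n * P n = P n)
    {G : ι → ι → ℂ} (hG : ∀ n, G n n = 1) (X : Matrix (Fin d) (Fin d) ℂ) :
    deph P (pdeph P G X) = deph P X := by
  simp [deph, mul_pdeph_mul hOrth hIdem, hG]

theorem trace_conjTranspose_mul_self_eq_sum_blocks (hHerm : ∀ n, (P n)ᴴ = P n)
    (hIdem : ∀ n, P n * P n = P n) (hSum : ∑ n, P n = 1) (X : Matrix (Fin d) (Fin d) ℂ) :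
    (Xᴴ * X).trace = ∑ n, ∑ m, ((P n * X * P m)ᴴ * (P n * X * P m)).trace := by
  have key : ∀ n m, ((P n * X * P m)ᴴ * (P n * X * P m)).trace = (Xᴴ * P n * X * P m).trace := by
    intro n m
    calc ((P n * X * P m)ᴴ * (P n * X * P m)).trace
        = (P m * (Xᴴ * (P n * P n) * X * P m)).trace := by
          simp only [conjTranspose_mul, hHerm, Matrix.mul_assoc]
      _ = (Xᴴ * P n * X * (P m * P m)).trace := by
          rw [Matrix.trace_mul_comm, hIdem]
          simp only [Matrix.mul_assoc]
      _ = _ := by rw [hIdem]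
  simp only [key, ← Matrix.trace_sum, ← Finset.mul_sum, hSum, Matrix.mul_one, ← Finset.sum_mul]

open scoped ComplexOrder in
theorem trace_conjTranspose_mul_self_re_nonneg (X : Matrix (Fin d) (Fin d) ℂ) :
    0 ≤ (Xᴴ * X).trace.re :=
  (Complex.le_def.mp (Matrix.posSemidef_conjTranspose_mul_self X).trace_nonneg).1

theorem trace_conjTranspose_smul_mul_smul_re (c : ℂ) (X : Matrix (Fin d) (Fin d) ℂ) :
    ((c • X)ᴴ * (c • X)).trace.re = ‖c‖ ^ 2 * (Xᴴ * X).trace.re := by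
  rw [conjTranspose_smul, Matrix.smul_mul, Matrix.mul_smul, smul_smul, Matrix.trace_smul,
    smul_eq_mul, Complex.star_def, ← Complex.normSq_eq_conj_mul_self, Complex.re_ofReal_mul,
    Complex.normSq_eq_norm_sq]

theorem frob_le_mul_frob_of_blocks (hHerm : ∀ n, (P n)ᴴ = P n)
    (hIdem : ∀ n, P n * P n = P n) (hSum : ∑ n, P n = 1) {X Y : Matrix (Fin d) (Fin d) ℂ}
    {C : ℝ} (hC : 0 ≤ C)
    (h : ∀ n m, ∃ c : ℂ, ‖c‖ ≤ C ∧ P n * Y * P m = c • (P n * X * P m)) :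
    frob Y ≤ C * frob X := by
  rw [frob, frob]
  refine Real.sqrt_le_iff.mpr ⟨by positivity, ?_⟩
  rw [mul_pow, Real.sq_sqrt (trace_conjTranspose_mul_self_re_nonneg X),
    trace_conjTranspose_mul_self_eq_sum_blocks hHerm hIdem hSum Y,
    trace_conjTranspose_mul_self_eq_sum_blocks hHerm hIdem hSum X]
  simp only [Complex.re_sum, Finset.mul_sum]
  refine Finset.sum_le_sum fun n _ => Finset.sum_le_sum fun m _ => ?_
  obtain ⟨c, hc, hY⟩ := h n m
  rw [hY, trace_conjTranspose_smul_mul_smul_re]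
  exact mul_le_mul_of_nonneg_right (pow_le_pow_left₀ (norm_nonneg c) hc 2)
    (trace_conjTranspose_mul_self_re_nonneg _)

variable [DecidableEq ι] [Nontrivial ι]

theorem norm_le_maxOffDiag (G : ι → ι → ℂ) {n m : ι} (h : n ≠ m) : ‖G n m‖ ≤ maxOffDiag G :=
  Finset.le_sup' (fun p : ι × ι => ‖G p.1 p.2‖) (b := (n, m)) (by simpa using h)

theorem maxOffDiag_nonneg (G : ι → ι → ℂ) : 0 ≤ maxOffDiag G := by
  obtain ⟨a, b, hab⟩ := exists_pair_ne ι
  exact (norm_nonneg _).trans (norm_le_maxOffDiag G hab)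

theorem frob_pdeph_sub_deph_le (hHerm : ∀ n, (P n)ᴴ = P n)
    (hOrth : ∀ n m, n ≠ m → P n * P m = 0) (hIdem : ∀ n, P n * P n = P n)
    (hSum : ∑ n, P n = 1) {G : ι → ι → ℂ} (hG : ∀ n, G n n = 1)
    (X : Matrix (Fin d) (Fin d) ℂ) :
    frob (pdeph P G X - deph P X) ≤ maxOffDiag G * frob (X - deph P X) := by
  refine frob_le_mul_frob_of_blocks hHerm hIdem hSum (maxOffDiag_nonneg G) fun n m => ?_
  simp only [deph_eq_pdeph, Matrix.mul_sub, Matrix.sub_mul, mul_pdeph_mul hOrth hIdem]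
  by_cases hnm : n = m
  · subst hnm
    exact ⟨0, by simpa using maxOffDiag_nonneg G, by simp [hG]⟩
  · exact ⟨G n m, norm_le_maxOffDiag G hnm, by simp [hnm]⟩

end Blocks

theorem deph_chainFun_pdeph {d : ℕ} {ι : Type*} [Fintype ι]
    {P : ι → Matrix (Fin d) (Fin d) ℂ}
    (hOrth : ∀ n m, n ≠ m → P n * P m = 0) (hIdem : ∀ n, P n * P n = P n)
    {G : ℕ → ι → ι → ℂ} (X : Matrix (Fin d) (Fin d) ℂ) (k : ℕ)
    (hG : ∀ j < k, ∀ n, G j n n = 1) :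
    deph P (chainFun (fun j => pdeph P (G j)) 0 k X) = deph P X := by
  induction k with
  | zero => rfl
  | succ k ih =>
    rw [chainFun, zero_add, deph_pdeph hOrth hIdem (hG k k.lt_succ_self),
      ih fun j hj => hG j (hj.trans k.lt_succ_self)]

theorem frob_chainFun_pdeph_sub_deph_le {d : ℕ} {ι : Type*}
    [Fintype ι] [DecidableEq ι] [Nontrivial ι] {P : ι → Matrix (Fin d) (Fin d) ℂ}
    (hHerm : ∀ n, (P n)ᴴ = P n) (hOrth : ∀ n m, n ≠ m → P n * P m = 0)
    (hIdem : ∀ n, P n * P n = P n) (hSum : ∑ n, P n = 1)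
    {G : ℕ → ι → ι → ℂ} (X : Matrix (Fin d) (Fin d) ℂ) (k : ℕ)
    (hG : ∀ j < k, ∀ n, G j n n = 1) :
    frob (chainFun (fun j => pdeph P (G j)) 0 k X - deph P X) ≤
      (∏ j ∈ Finset.range k, maxOffDiag (G j)) * frob (X - deph P X) := by
  induction k with
  | zero => simp [chainFun]
  | succ k ih =>
    have hG' : ∀ j < k, ∀ n, G j n n = 1 := fun j hj => hG j (hj.trans k.lt_succ_self)
    have hstep := frob_pdeph_sub_deph_le hHerm hOrth hIdem hSum (hG k k.lt_succ_self)
      (chainFun (fun j => pdeph P (G j)) 0 k X)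
    rw [deph_chainFun_pdeph hOrth hIdem X k hG'] at hstep
    rw [chainFun, zero_add, Finset.prod_range_succ, mul_comm (∏ j ∈ _, _), mul_assoc]
    exact hstep.trans (mul_le_mul_of_nonneg_left (ih hG') (maxOffDiag_nonneg _))

/-- for Hermitian `ϱ` and coefficient families `G⁽⁰⁾, …, G⁽ᵏ⁾` with unit
diagonals, `‖(𝒢_{G⁽ᵏ⁾} ∘ ⋯ ∘ 𝒢_{G⁽⁰⁾})(ϱ) − 𝒟(ϱ)‖₂ ≤
(∏_{j=0}^{k} max_{n≠m} |G⁽ʲ⁾_{nm}|) ‖ϱ − 𝒟(ϱ)‖₂`. -/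
theorem multi_step_equilibration_bound {d : ℕ} {ι : Type*}
    [Fintype ι] [DecidableEq ι] [Nontrivial ι]
    (P : ι → Matrix (Fin d) (Fin d) ℂ)
    (hHerm : ∀ n, (P n)ᴴ = P n)
    (hOrth : ∀ n m, n ≠ m → P n * P m = 0)
    (hIdem : ∀ n, P n * P n = P n)
    (hSum : ∑ n, P n = 1)
    (ϱ : Matrix (Fin d) (Fin d) ℂ) (hϱ : ϱᴴ = ϱ)
    (k : ℕ) (G : ℕ → ι → ι → ℂ)
    (hG : ∀ j, j ≤ k → ∀ n, G j n n = 1) :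
    frob (chainFun (fun j => pdeph P (G j)) 0 (k + 1) ϱ - deph P ϱ) ≤
      (∏ j ∈ Finset.range (k + 1), maxOffDiag (G j)) * frob (ϱ - deph P ϱ) := by
  exact frob_chainFun_pdeph_sub_deph_le hHerm hOrth hIdem hSum ϱ (k + 1)
    fun j hj => hG j (Nat.lt_succ_iff.mp hj)
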